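/- Let H : ℝⁿ → ℝ be differentiable with discrete gradient ∇̄H, let S(x) = sᵀx be linear with s ∈ ℝⁿ, let J₁,…,J_k, M₁,…,M_l ∈ ℝⁿˣⁿ be constant skew-symmetric matrices with s ∈ ker M_α for every α, let γ̂ᵢ be strictly positive functions, and let h > 0. If x_k, x_{k+1} ∈ ℝⁿ satisfy the closed (no-input) discrete scheme (x_{k+1} − x_k)/h = Σᵢ γ̂ᵢ(x_{k+1/2}) (sᵀJᵢ∇̄H(x_k,x_{k+1})) Jᵢ ∇̄H(x_k,x_{k+1}) + Σ_α M_α ∇̄H(x_k,x_{k+1}), then H(x_{k+1}) = H(x_k) and S(x_{k+1}) − S(x_k) = h Σᵢ γ̂ᵢ(x_{k+1/2}) (sᵀJᵢ∇̄H(x_k,x_{k+1}))² ≥ 0; i.e., the scheme exactly conserves the energy and produces nonnegative entropy at each step. -/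

import Mathlib

open Matrix

/-- A discrete gradient of a differentiable function `H : ℝⁿ → ℝ`: a continuous map
`∇̄H : ℝⁿ × ℝⁿ → ℝⁿ` with `∇̄H(x,x')ᵀ(x'−x) = H(x') − H(x)` and `∇̄H(x,x) = ∇H(x)`. -/
def IsDiscreteGradient {n : ℕ} (H : EuclideanSpace ℝ (Fin n) → ℝ)
    (DH : EuclideanSpace ℝ (Fin n) → EuclideanSpace ℝ (Fin n) → EuclideanSpace ℝ (Fin n)) :
    Prop :=
  Continuous (fun p : EuclideanSpace ℝ (Fin n) × EuclideanSpace ℝ (Fin n) => DH p.1 p.2) ∧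
  (∀ x x' : EuclideanSpace ℝ (Fin n), DH x x' ⬝ᵥ (x' - x) = H x' - H x) ∧
  (∀ x : EuclideanSpace ℝ (Fin n), DH x x = gradient H x)

/-- The quadratic form of a skew-symmetric real matrix vanishes. -/
theorem dotProduct_mulVec_self_of_transpose_eq_neg {ι : Type*} [Fintype ι]
    {A : Matrix ι ι ℝ} (hA : Aᵀ = -A) (v : ι → ℝ) : v ⬝ᵥ A *ᵥ v = 0 := by
  have key : v ⬝ᵥ A *ᵥ v = -(v ⬝ᵥ A *ᵥ v) := by
    conv_lhs => rw [dotProduct_mulVec, ← mulVec_transpose, hA, neg_mulVec, neg_dotProduct,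
      dotProduct_comm]
  linarith

/-- A vector in the kernel of a skew-symmetric matrix is orthogonal to its range. -/
theorem dotProduct_mulVec_eq_zero_of_transpose_eq_neg {ι : Type*} [Fintype ι]
    {A : Matrix ι ι ℝ} (hA : Aᵀ = -A) {s : ι → ℝ} (hs : A *ᵥ s = 0) (v : ι → ℝ) :
    s ⬝ᵥ A *ᵥ v = 0 := by
  rw [dotProduct_mulVec, ← mulVec_transpose, hA, neg_mulVec, hs, neg_zero, zero_dotProduct]

/-- the closed (no-input) discrete gradient scheme
`(x_{k+1} − x_k)/h = Σᵢ γ̂ᵢ(x_{k+1/2}) (sᵀJᵢ∇̄H) Jᵢ∇̄H + Σ_α M_α ∇̄H`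
with constant skew-symmetric `Jᵢ`, `M_α`, linear entropy `S(x) = sᵀx` with `s ∈ ker M_α`,
exactly conserves the energy and produces nonnegative entropy at each step. -/
theorem closed_discrete_iphs_energy_entropy {n k l : ℕ}
    (H : EuclideanSpace ℝ (Fin n) → ℝ) (hH : Differentiable ℝ H)
    (DH : EuclideanSpace ℝ (Fin n) → EuclideanSpace ℝ (Fin n) → EuclideanSpace ℝ (Fin n))
    (hDH : IsDiscreteGradient H DH)
    (s : Fin n → ℝ) (S : EuclideanSpace ℝ (Fin n) → ℝ) (hSdef : ∀ z, S z = s ⬝ᵥ z)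
    (J : Fin k → Matrix (Fin n) (Fin n) ℝ) (hJ : ∀ i, (J i)ᵀ = -(J i))
    (M : Fin l → Matrix (Fin n) (Fin n) ℝ) (hM : ∀ a, (M a)ᵀ = -(M a))
    (hker : ∀ a, (M a).mulVec s = 0)
    (γ : Fin k → EuclideanSpace ℝ (Fin n) → ℝ) (hγ : ∀ i z, 0 < γ i z)
    (h : ℝ) (hh : 0 < h)
    (xk xk1 : EuclideanSpace ℝ (Fin n))
    (hscheme : (1 / h) • (xk1 - xk) =
      ∑ i, (γ i ((1 / 2 : ℝ) • (xk + xk1)) * (s ⬝ᵥ (J i).mulVec (DH xk xk1))) •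
          (J i).mulVec (DH xk xk1)
        + ∑ a, (M a).mulVec (DH xk xk1)) :
    H xk1 = H xk
    ∧ S xk1 - S xk =
        h * ∑ i, γ i ((1 / 2 : ℝ) • (xk + xk1)) * (s ⬝ᵥ (J i).mulVec (DH xk xk1)) ^ 2
    ∧ 0 ≤ h * ∑ i, γ i ((1 / 2 : ℝ) • (xk + xk1)) * (s ⬝ᵥ (J i).mulVec (DH xk xk1)) ^ 2 := by
  obtain ⟨-, hdiff, -⟩ := hDH
  have hstep (v : Fin n → ℝ) : v ⬝ᵥ (xk1 - xk) = h * (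
      ∑ i, (γ i ((1 / 2 : ℝ) • (xk + xk1)) * (s ⬝ᵥ (J i).mulVec (DH xk xk1))) *
          (v ⬝ᵥ (J i).mulVec (DH xk xk1))
        + ∑ a, v ⬝ᵥ (M a).mulVec (DH xk xk1)) := by
    have hv := congrArg (fun w : Fin n → ℝ => h * (v ⬝ᵥ w)) hscheme
    simp only [dotProduct_add, dotProduct_sum, dotProduct_smul, smul_eq_mul] at hv
    rw [← hv]
    field_simp
  refine ⟨?_, ?_, ?_⟩
  · rw [← sub_eq_zero, ← hdiff, hstep]
    simp [dotProduct_mulVec_self_of_transpose_eq_neg, hJ, hM]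
  · rw [hSdef, hSdef, ← dotProduct_sub, hstep]
    simp [dotProduct_mulVec_eq_zero_of_transpose_eq_neg, hM, hker, pow_two, mul_assoc]
  · exact mul_nonneg hh.le
      (Finset.sum_nonneg fun i _ => mul_nonneg (hγ i _).le (sq_nonneg _))
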